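/- arXiv:1909.00719 — 2 statements merged into one kernel-verified Lean document; each statement's English description precedes it below -/
import Mathlib

section
/- Let A ⊂ ℝ^D be a compact set and let f_θ be a single-hidden layer ReLU neural network from ℝ^D to ℝ^K whose parameters θ are mutually independent Gaussian random variables with fixed means μ and with every standard deviation equal to a shared constant σ > 0; let f_μ denote the deterministic network whose parameters equal the means μ. For any ε > 0 and any μ, there exists σ₁ > 0 such that for any shared standard deviation 0 < σ < σ₁, sup_{x ∈ A} |E[ψ(f^(k)_θ(x))] − ψ(f^(k)_μ(x))| < ε for every 1 ≤ k ≤ K. -/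
open MeasureTheory ProbabilityTheory Finset

/-- Index type for the parameters of a single-hidden-layer network `ℝ^D → ℝ^K` with `I`
hidden units: input weights `(i, d)`, input biases `i`, output weights `(k, i)`, output
biases `k`. -/
abbrev ParamIdx (D I K : ℕ) : Type := (Fin I × Fin D) ⊕ (Fin I ⊕ ((Fin K × Fin I) ⊕ Fin K))

/-- The `k`-th output of the single-hidden-layer ReLU network with parameters `θ`. -/
def net1 {D I K : ℕ} (θ : ParamIdx D I K → ℝ) (x : Fin D → ℝ) (k : Fin K) : ℝ :=
  (∑ i, θ (.inr (.inr (.inl (k, i)))) *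
      max 0 ((∑ d, θ (.inl (i, d)) * x d) + θ (.inr (.inl i)))) +
    θ (.inr (.inr (.inr k)))

/-- The fully-factorised Gaussian distribution over the parameters, with means `μ` and a
shared standard deviation `σ` for every parameter. -/
noncomputable def gaussParams {D I K : ℕ} (μ : ParamIdx D I K → ℝ) (σ : ℝ) :
    Measure (ParamIdx D I K → ℝ) :=
  Measure.pi fun j => gaussianReal (μ j) (Real.toNNReal (σ ^ 2))

lemma integrable_sq_sub_gaussianReal (m : ℝ) (v : NNReal) :
    Integrable (fun t : ℝ => (t - m) ^ 2) (gaussianReal m v) :=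
  (((memLp_id_gaussianReal 2).sub (memLp_const m)).integrable_sq :)

lemma integral_sq_sub_gaussianReal (m : ℝ) (v : NNReal) :
    ∫ t : ℝ, (t - m) ^ 2 ∂(gaussianReal m v) = v := by
  have h := variance_id_gaussianReal (μ := m) (v := v)
  rw [variance_eq_integral (by fun_prop)] at h
  simpa only [id_eq, integral_id_gaussianReal] using h

instance isProbabilityMeasure_gaussParams {D I K : ℕ} (μ : ParamIdx D I K → ℝ) (σ : ℝ) :
    IsProbabilityMeasure (gaussParams μ σ) := by
  unfold gaussParams; infer_instance

lemma integrable_sq_sub_gaussParams {D I K : ℕ} (μ : ParamIdx D I K → ℝ) (σ : ℝ)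
    (j : ParamIdx D I K) : Integrable (fun θ => (θ j - μ j) ^ 2) (gaussParams μ σ) :=
  integrable_comp_eval (μ := fun j => gaussianReal (μ j) (Real.toNNReal (σ ^ 2)))
    (integrable_sq_sub_gaussianReal (μ j) _)

lemma integrable_sum_sq_gaussParams {D I K : ℕ} (μ : ParamIdx D I K → ℝ) (σ : ℝ) :
    Integrable (fun θ => ∑ j, (θ j - μ j) ^ 2) (gaussParams μ σ) :=
  integrable_finsetSum _ fun j _ => integrable_sq_sub_gaussParams μ σ j

lemma integral_sum_sq_gaussParams {D I K : ℕ} (μ : ParamIdx D I K → ℝ) (σ : ℝ) :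
    ∫ θ, ∑ j, (θ j - μ j) ^ 2 ∂(gaussParams μ σ) = Fintype.card (ParamIdx D I K) * σ ^ 2 := by
  have h (j : ParamIdx D I K) : ∫ θ, (θ j - μ j) ^ 2 ∂(gaussParams μ σ) = σ ^ 2 := by
    have h1 := integral_comp_eval (μ := fun j => gaussianReal (μ j) (Real.toNNReal (σ ^ 2)))
      (i := j) (integrable_sq_sub_gaussianReal (μ j) _).aestronglyMeasurable
    rw [gaussParams, h1, integral_sq_sub_gaussianReal, Real.coe_toNNReal _ (sq_nonneg σ)]
  rw [integral_finsetSum _ fun j _ => integrable_sq_sub_gaussParams μ σ j]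
  simp only [h, sum_const, card_univ, nsmul_eq_mul]

lemma continuous_net1 {D I K : ℕ} (x : Fin D → ℝ) (k : Fin K) :
    Continuous fun θ : ParamIdx D I K → ℝ => net1 θ x k := by
  unfold net1; fun_prop

lemma abs_affine_le {D : ℕ} {u x : Fin D → ℝ} {v S M : ℝ} (hu : ∀ d, |u d| ≤ S) (hv : |v| ≤ S)
    (hx : ∀ d, |x d| ≤ M) : |(∑ d, u d * x d) + v| ≤ (D * M + 1) * S := by
  have h : |∑ d, u d * x d| ≤ ∑ _d : Fin D, S * M := by
    refine (abs_sum_le_sum_abs _ _).trans (sum_le_sum fun d _ => ?_)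
    rw [abs_mul]
    exact mul_le_mul (hu d) (hx d) (abs_nonneg _) ((abs_nonneg _).trans (hu d))
  rw [sum_const, card_univ, Fintype.card_fin, nsmul_eq_mul] at h
  linarith [abs_add_le (∑ d, u d * x d) v]

lemma abs_relu_sub_relu_le (a b : ℝ) : |max 0 a - max 0 b| ≤ |a - b| := by
  simpa [max_comm] using abs_max_sub_max_le_abs a b 0

lemma abs_net1_sub_net1_le {D I K : ℕ} {θ μ : ParamIdx D I K → ℝ} {x : Fin D → ℝ} {S T M : ℝ}
    (hS : ∀ j, |θ j - μ j| ≤ S) (hT : ∀ j, |μ j| ≤ T) (hM : 0 ≤ M) (hx : ∀ d, |x d| ≤ M)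
    (k : Fin K) :
    |net1 θ x k - net1 μ x k| ≤ I * (D * M + 1) * (S ^ 2 + 2 * T * S) + S := by
  have hS0 : 0 ≤ S := (abs_nonneg _).trans (hS (.inr (.inr (.inr k))))
  have hT0 : 0 ≤ T := (abs_nonneg _).trans (hT (.inr (.inr (.inr k))))
  have hL : 0 ≤ D * M + 1 := by positivity
  let h (θ : ParamIdx D I K → ℝ) (i : Fin I) : ℝ :=
    max 0 ((∑ d, θ (.inl (i, d)) * x d) + θ (.inr (.inl i)))
  let w (θ : ParamIdx D I K → ℝ) (i : Fin I) : ℝ := θ (.inr (.inr (.inl (k, i))))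
  have hdiff (i : Fin I) : |h θ i - h μ i| ≤ (D * M + 1) * S := by
    refine (abs_relu_sub_relu_le _ _).trans ?_
    have := abs_affine_le (u := fun d => θ (.inl (i, d)) - μ (.inl (i, d)))
      (v := θ (.inr (.inl i)) - μ (.inr (.inl i))) (fun d => hS _) (hS _) hx
    simp only [sub_mul, sum_sub_distrib] at this
    rwa [add_sub_add_comm]
  have hbase (i : Fin I) : |h μ i| ≤ (D * M + 1) * T := by
    have h1 := abs_relu_sub_relu_le ((∑ d, μ (.inl (i, d)) * x d) + μ (.inr (.inl i))) 0
    rw [max_self, sub_zero, sub_zero] at h1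
    exact h1.trans (abs_affine_le (fun d => hT _) (hT _) hx)
  have hunit (i : Fin I) :
      |w θ i * h θ i - w μ i * h μ i| ≤ (D * M + 1) * (S ^ 2 + 2 * T * S) := by
    have e : w θ i * h θ i - w μ i * h μ i = (w θ i - w μ i) * (h θ i - h μ i)
        + (w θ i - w μ i) * h μ i + w μ i * (h θ i - h μ i) := by ring
    rw [e]
    refine (abs_add_three _ _ _).trans ?_
    rw [abs_mul, abs_mul, abs_mul]
    have h1 := mul_le_mul (hS (.inr (.inr (.inl (k, i))))) (hdiff i) (abs_nonneg _) hS0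
    have h2 := mul_le_mul (hS (.inr (.inr (.inl (k, i))))) (hbase i) (abs_nonneg _) hS0
    have h3 := mul_le_mul (hT (.inr (.inr (.inl (k, i))))) (hdiff i) (abs_nonneg _) hT0
    linarith
  have hsum : |∑ i, (w θ i * h θ i - w μ i * h μ i)| ≤
      I * ((D * M + 1) * (S ^ 2 + 2 * T * S)) := by
    refine (abs_sum_le_sum_abs _ _).trans ((sum_le_sum fun i _ => hunit i).trans ?_)
    simp
  have e : net1 θ x k - net1 μ x k = ∑ i, (w θ i * h θ i - w μ i * h μ i)
      + (θ (.inr (.inr (.inr k))) - μ (.inr (.inr (.inr k)))) := by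
    simp only [net1, w, h, sum_sub_distrib]
    ring
  rw [e, mul_assoc]
  exact (abs_add_le _ _).trans (add_le_add hsum (hS _))

lemma abs_relu_net1_sub_le {D I K : ℕ} {μ : ParamIdx D I K → ℝ} {x : Fin D → ℝ} {T M δ : ℝ}
    (hT : ∀ j, |μ j| ≤ T) (hT0 : 0 ≤ T) (hM : 0 ≤ M) (hx : ∀ d, |x d| ≤ M) (hδ : 0 < δ)
    (k : Fin K) (θ : ParamIdx D I K → ℝ) :
    |max 0 (net1 θ x k) - max 0 (net1 μ x k)| ≤
      (2 * (I * (D * M + 1)) * T + 1) * δ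
      + (I * (D * M + 1) + (2 * (I * (D * M + 1)) * T + 1) / δ) * ∑ j, (θ j - μ j) ^ 2 := by
  set Q := ∑ j, (θ j - μ j) ^ 2
  have hQ0 : 0 ≤ Q := sum_nonneg fun j _ => sq_nonneg _
  have hS (j) : |θ j - μ j| ≤ √Q :=
    Real.abs_le_sqrt (single_le_sum (f := fun j => (θ j - μ j) ^ 2)
      (fun j _ => sq_nonneg _) (mem_univ j))
  have hnet := (abs_relu_sub_relu_le _ _).trans (abs_net1_sub_net1_le hS hT hM hx k)
  have hyoung : √Q ≤ δ + Q / δ := by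
    rw [← sub_le_iff_le_add', le_div_iff₀ hδ]
    nlinarith [Real.sq_sqrt hQ0, Real.sqrt_nonneg Q, sq_nonneg (√Q - δ)]
  have hC : 0 ≤ 2 * (I * (D * M + 1)) * T + 1 := by positivity
  have := mul_le_mul_of_nonneg_left hyoung hC
  rw [Real.sq_sqrt hQ0] at hnet
  refine hnet.trans ?_
  have e : (2 * (I * (D * M + 1)) * T + 1) / δ * Q
      = (2 * (I * (D * M + 1)) * T + 1) * (Q / δ) := by ring
  rw [add_mul (I * (D * M + 1) : ℝ), e]
  linarith

lemma abs_integral_relu_net1_sub_le {D I K : ℕ} {μ : ParamIdx D I K → ℝ} {x : Fin D → ℝ}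
    {k : Fin K} {a b : ℝ} (σ : ℝ)
    (h : ∀ θ : ParamIdx D I K → ℝ, |max 0 (net1 θ x k) - max 0 (net1 μ x k)| ≤
      a + b * ∑ j, (θ j - μ j) ^ 2) :
    |(∫ θ, max 0 (net1 θ x k) ∂(gaussParams μ σ)) - max 0 (net1 μ x k)| ≤
      a + b * (Fintype.card (ParamIdx D I K) * σ ^ 2) := by
  have hQ := (integrable_sum_sq_gaussParams μ σ).const_mul b
  have hbound := (integrable_const (μ := gaussParams μ σ) a).add hQ
  have hcont : Continuous fun θ : ParamIdx D I K → ℝ => max 0 (net1 θ x k) :=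
    continuous_const.max (continuous_net1 x k)
  have hsub : Integrable (fun θ => max 0 (net1 θ x k) - max 0 (net1 μ x k))
      (gaussParams μ σ) :=
    hbound.mono' (hcont.sub continuous_const).aestronglyMeasurable (.of_forall h)
  have hint : Integrable (fun θ => max 0 (net1 θ x k)) (gaussParams μ σ) := by
    refine (hsub.add (integrable_const (max 0 (net1 μ x k)))).congr (.of_forall fun θ => ?_)
    simp
  have hnorm := norm_integral_le_of_norm_le
    (f := fun θ => max 0 (net1 θ x k) - max 0 (net1 μ x k)) hbound (.of_forall h)
  rw [integral_sub hint (integrable_const _)] at hnorm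
  simp only [Pi.add_apply] at hnorm
  rw [integral_add (integrable_const _) hQ, integral_const_mul,
    integral_sum_sq_gaussParams] at hnorm
  simpa using hnorm

/-- For a single-hidden-layer ReLU network whose parameters are mutually
independent Gaussians with fixed means `μ` and shared standard deviation `σ`, for every
compact `A`, `ε > 0` and any `μ` there is `σ₁ > 0` such that for all `0 < σ < σ₁`,
`|E[ψ(f^(k)_θ(x))] − ψ(f^(k)_μ(x))| < ε` for all `x ∈ A` and every `k`, where `f_μ` is the
deterministic network with parameters equal to the means `μ`. -/
theorem mean_close_to_map (D I K : ℕ) (μ : ParamIdx D I K → ℝ)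
    (A : Set (Fin D → ℝ)) (hA : IsCompact A) (ε : ℝ) (hε : 0 < ε) :
    ∃ σ₁ > (0 : ℝ), ∀ σ : ℝ, 0 < σ → σ < σ₁ → ∀ x ∈ A, ∀ k : Fin K,
      |(∫ θ, max 0 (net1 θ x k) ∂(gaussParams μ σ)) - max 0 (net1 μ x k)| < ε := by
  obtain ⟨M, hM0, hM⟩ := hA.isBounded.exists_pos_norm_le
  set T := ∑ j, |μ j|
  have hT (j) : |μ j| ≤ T := single_le_sum (f := fun j => |μ j|) (fun j _ => abs_nonneg _)
    (mem_univ j)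
  have hT0 : 0 ≤ T := sum_nonneg fun j _ => abs_nonneg _
  set C : ℝ := 2 * (I * (D * M + 1)) * T + 1 with hC
  have hC0 : 0 < C := by positivity
  set δ : ℝ := ε / (2 * C) with hδ
  have hδ0 : 0 < δ := by positivity
  set G : ℝ := I * (D * M + 1) + C / δ with hG
  have hG0 : 0 < G := by positivity
  set n : ℝ := (Fintype.card (ParamIdx D I K) : ℝ)
  have hn0 : 0 ≤ n := Nat.cast_nonneg _
  refine ⟨√(ε / (2 * (G * n + 1))), Real.sqrt_pos.2 (by positivity), fun σ hσ hσ₁ x hx k => ?_⟩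
  refine (abs_integral_relu_net1_sub_le σ (abs_relu_net1_sub_le hT hT0 hM0.le
    (fun d => (norm_le_pi_norm x d).trans (hM x hx)) hδ0 k)).trans_lt ?_
  rw [← hC, ← hG]
  have hσ2 : σ ^ 2 < ε / (2 * (G * n + 1)) := (Real.lt_sqrt hσ.le).1 hσ₁
  rw [lt_div_iff₀ (by positivity)] at hσ2
  have hCδ : C * δ = ε / 2 := by rw [hδ]; field_simp
  have hσ0 : 0 < σ ^ 2 := by positivity
  linarith
end

section
/- Let N(r) = (2π)^{−1/2} e^{−r²/2} be the standard Gaussian pdf and Φ(r) = ∫_{−∞}^r N(t) dt the standard Gaussian cdf. Define h(r) = N(r) + rΦ(r) and α(r) = Φ(r) + r·h(r) − h(r)². Then α'(r) = 2h(r)(1 − Φ(r)) for all r ∈ ℝ, and in particular α is strictly increasing on ℝ (since h(r) > 0 and Φ(r) < 1). -/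
open Real

/-- The standard Gaussian probability density function. -/
noncomputable def stdGaussPdf (r : ℝ) : ℝ := (Real.sqrt (2 * Real.pi))⁻¹ * Real.exp (-r ^ 2 / 2)

/-- The standard Gaussian cumulative distribution function. -/
noncomputable def stdGaussCdf (r : ℝ) : ℝ := ∫ t in Set.Iic r, stdGaussPdf t

/-- `h(r) = N(r) + r Φ(r)`. -/
noncomputable def hFun (r : ℝ) : ℝ := stdGaussPdf r + r * stdGaussCdf r

/-- `α(r) = Φ(r) + r h(r) - h(r)²`. -/
noncomputable def alphaFun (r : ℝ) : ℝ := stdGaussCdf r + r * hFun r - (hFun r) ^ 2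

open MeasureTheory Set Filter Topology

lemma stdGaussPdf_eq_gaussianPDFReal :
    stdGaussPdf = ProbabilityTheory.gaussianPDFReal 0 1 := by
  funext r
  simp [stdGaussPdf, ProbabilityTheory.gaussianPDFReal]

lemma stdGaussPdf_pos (r : ℝ) : 0 < stdGaussPdf r := by
  rw [stdGaussPdf]
  positivity

lemma continuous_stdGaussPdf : Continuous stdGaussPdf := by
  unfold stdGaussPdf
  fun_prop

lemma integrable_stdGaussPdf : Integrable stdGaussPdf := by
  rw [stdGaussPdf_eq_gaussianPDFReal]
  exact ProbabilityTheory.integrable_gaussianPDFReal 0 1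

lemma integral_stdGaussPdf : ∫ t, stdGaussPdf t = 1 := by
  rw [stdGaussPdf_eq_gaussianPDFReal]
  exact ProbabilityTheory.integral_gaussianPDFReal_eq_one 0 one_ne_zero

lemma hasDerivAt_stdGaussPdf (r : ℝ) : HasDerivAt stdGaussPdf (-r * stdGaussPdf r) r := by
  have h := ((((hasDerivAt_id r).pow 2).neg.div_const 2).exp).const_mul (√(2 * π))⁻¹
  refine h.congr_deriv ?_
  simp [stdGaussPdf]
  ring

lemma hasDerivAt_stdGaussCdf (r : ℝ) : HasDerivAt stdGaussCdf (stdGaussPdf r) r := by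
  have h : stdGaussCdf = fun x ↦ stdGaussCdf 0 + ∫ t in (0 : ℝ)..x, stdGaussPdf t := by
    funext x
    rw [← intervalIntegral.integral_Iic_sub_Iic integrable_stdGaussPdf.integrableOn
      integrable_stdGaussPdf.integrableOn]
    simp [stdGaussCdf]
  rw [h]
  exact (continuous_stdGaussPdf.integral_hasStrictDerivAt 0 r).hasDerivAt.const_add _

lemma strictMono_stdGaussCdf : StrictMono stdGaussCdf :=
  strictMono_of_hasDerivAt_pos hasDerivAt_stdGaussCdf stdGaussPdf_pos

lemma stdGaussCdf_pos (r : ℝ) : 0 < stdGaussCdf r :=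
  (integral_nonneg fun t ↦ (stdGaussPdf_pos t).le).trans_lt
    (strictMono_stdGaussCdf (sub_one_lt r))

lemma stdGaussCdf_lt_one (r : ℝ) : stdGaussCdf r < 1 := by
  refine (strictMono_stdGaussCdf (lt_add_one r)).trans_le ?_
  rw [← integral_stdGaussPdf]
  exact setIntegral_le_integral integrable_stdGaussPdf
    (ae_of_all _ fun t ↦ (stdGaussPdf_pos t).le)

lemma hasDerivAt_hFun (r : ℝ) : HasDerivAt hFun (stdGaussCdf r) r := by
  refine ((hasDerivAt_stdGaussPdf r).add
    ((hasDerivAt_id r).mul (hasDerivAt_stdGaussCdf r))).congr_deriv ?_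
  simp

lemma strictMono_hFun : StrictMono hFun :=
  strictMono_of_hasDerivAt_pos hasDerivAt_hFun stdGaussCdf_pos

lemma integrable_neg_mul_stdGaussPdf : Integrable fun t ↦ -t * stdGaussPdf t := by
  refine ((integrable_mul_exp_neg_mul_sq one_half_pos).const_mul (-(√(2 * π))⁻¹)).congr
    (ae_of_all _ fun t ↦ ?_)
  simp only [stdGaussPdf]
  rw [show -(1 / 2) * t ^ 2 = -t ^ 2 / 2 by ring]
  ring

lemma tendsto_stdGaussPdf_atBot : Tendsto stdGaussPdf atBot (𝓝 0) :=
  tendsto_zero_of_hasDerivAt_of_integrableOn_Iic (a := 0)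
    (fun t _ ↦ hasDerivAt_stdGaussPdf t)
    integrable_neg_mul_stdGaussPdf.integrableOn integrable_stdGaussPdf.integrableOn

lemma hFun_eq_integral (r : ℝ) : hFun r = ∫ t in Iic r, (r - t) * stdGaussPdf t := by
  have h := integral_Iic_of_hasDerivAt_of_tendsto' (a := r)
    (fun t _ ↦ hasDerivAt_stdGaussPdf t) integrable_neg_mul_stdGaussPdf.integrableOn
    tendsto_stdGaussPdf_atBot
  rw [sub_zero] at h
  rw [hFun, stdGaussCdf, ← h, ← integral_const_mul,
    ← integral_add integrable_neg_mul_stdGaussPdf.integrableOn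
      (integrable_stdGaussPdf.const_mul r).integrableOn]
  congr with t
  ring

lemma hFun_pos (r : ℝ) : 0 < hFun r := by
  refine lt_of_le_of_lt ?_ (strictMono_hFun (sub_one_lt r))
  rw [hFun_eq_integral]
  exact setIntegral_nonneg measurableSet_Iic fun t ht ↦
    mul_nonneg (sub_nonneg.2 ht) (stdGaussPdf_pos t).le

lemma hasDerivAt_alphaFun (r : ℝ) :
    HasDerivAt alphaFun (2 * hFun r * (1 - stdGaussCdf r)) r := by
  refine (((hasDerivAt_stdGaussCdf r).add ((hasDerivAt_id r).mul (hasDerivAt_hFun r))).sub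
    ((hasDerivAt_hFun r).pow 2)).congr_deriv ?_
  simp [hFun]
  ring

/-- `α'(r) = 2 h(r) (1 - Φ(r))` for all `r`, and `α` is strictly
increasing on `ℝ`. -/
theorem alphaFun_deriv_strictMono :
    (∀ r : ℝ, HasDerivAt alphaFun (2 * hFun r * (1 - stdGaussCdf r)) r) ∧
      StrictMono alphaFun := by
  refine ⟨hasDerivAt_alphaFun, strictMono_of_hasDerivAt_pos hasDerivAt_alphaFun fun r ↦ ?_⟩
  exact mul_pos (mul_pos two_pos (hFun_pos r)) (sub_pos.2 (stdGaussCdf_lt_one r))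
end
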